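/- Let d ∈ ℕ, α ∈ (0,1/2), λ > 0, and let k_λ(x,y) = σ_λ(x)σ_λ(y)·k̃_λ(‖x−y‖) be a weighted kernel on D = [0,1]^d with σ_λ(x) = exp(λ^{−α}‖x‖²), so that k_λ(x,x) = k̃(0)·exp(2λ^{−α}‖x‖²). Then ∫_D k_λ(x,x) dx = 2^{−d/2}·k̃(0)·λ^{αd/2}·( ∫_0^{√(2/λ^α)} e^{t²} dt )^d. Moreover, there exist constants λ₀ > 0 and c₁, c₂ > 0 (depending only on d) such that for all 0 < λ < λ₀: c₁·k̃(0)·λ^{αd}·e^{2d/λ^α} ≤ ∫_D k_λ(x,x) dx ≤ c₂·k̃(0)·λ^{αd}·e^{2d/λ^α}. -/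

import Mathlib

open MeasureTheory

noncomputable section

/-- The domain `D = [0,1]^d ⊆ ℝ^d` (with the Euclidean norm). -/
def Dset (d : ℕ) : Set (EuclideanSpace ℝ (Fin d)) := {x | ∀ i, x i ∈ Set.Icc (0:ℝ) 1}

/-- Lebesgue measure restricted to the domain `D = [0,1]^d`. -/
def μD (d : ℕ) : Measure (EuclideanSpace ℝ (Fin d)) := volume.restrict (Dset d)

lemma integral_exp_mul_norm_sq_unitCube (d : ℕ) (s : ℝ) :
    (∫ x, Real.exp (s * ‖x‖ ^ 2) ∂(μD d)) = (∫ t in (0:ℝ)..1, Real.exp (s * t ^ 2)) ^ d := by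
  have hmeas : MeasurableSet (Dset d) := by
    have : Dset d = ⋂ i, (fun x : EuclideanSpace ℝ (Fin d) => x i) ⁻¹' Set.Icc (0:ℝ) 1 := by
      ext x; simp [Dset]
    rw [this]
    exact MeasurableSet.iInter fun i => by
      apply measurableSet_Icc.preimage
      fun_prop
  set g : ℝ → ℝ := (Set.Icc (0:ℝ) 1).indicator fun t => Real.exp (s * t ^ 2) with hg
  have hprod : (Dset d).indicator (fun x => Real.exp (s * ‖x‖ ^ 2)) = fun x => ∏ i, g (x i) := by
    funext x
    by_cases hx : x ∈ Dset d
    · rw [Set.indicator_of_mem hx, EuclideanSpace.norm_sq_eq, Finset.mul_sum, Real.exp_sum]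
      refine Finset.prod_congr rfl fun i _ => ?_
      rw [hg, Set.indicator_of_mem (hx i), Real.norm_eq_abs, sq_abs]
    · rw [Set.indicator_of_notMem hx]
      obtain ⟨i, hi⟩ : ∃ i, x i ∉ Set.Icc (0:ℝ) 1 := by simpa [Dset] using hx
      exact (Finset.prod_eq_zero (Finset.mem_univ i) (Set.indicator_of_notMem hi _)).symm
  rw [μD, ← integral_indicator hmeas, hprod]
  have h := (EuclideanSpace.volume_preserving_symm_measurableEquiv_toLp (Fin d)).integral_comp'
    (fun y : Fin d → ℝ => ∏ i, g (y i))
  refine Eq.trans h ?_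
  rw [integral_fintype_prod_volume_eq_pow g, Fintype.card_fin, hg,
    integral_indicator measurableSet_Icc, integral_Icc_eq_integral_Ioc,
    intervalIntegral.integral_of_le zero_le_one]

lemma integral_exp_sq_sqrt {s : ℝ} (hs : 0 ≤ s) :
    ∫ t in (0:ℝ)..Real.sqrt s, Real.exp (t ^ 2) =
      Real.sqrt s * ∫ t in (0:ℝ)..1, Real.exp (s * t ^ 2) := by
  have h := intervalIntegral.mul_integral_comp_mul_left (a := 0) (b := 1)
    (f := fun t => Real.exp (t ^ 2)) (Real.sqrt s)
  simp only [mul_zero, mul_one, mul_pow, Real.sq_sqrt hs] at h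
  exact h.symm

lemma integral_exp_mul_unitInterval {c : ℝ} (hc : c ≠ 0) :
    ∫ t in (0:ℝ)..1, Real.exp (c * t) = (Real.exp c - 1) / c := by
  rw [intervalIntegral.integral_comp_mul_left (fun t => Real.exp t) hc]
  simp [integral_exp, div_eq_inv_mul]

lemma integral_exp_mul_sq_le {s : ℝ} (hs : 0 < s) :
    ∫ t in (0:ℝ)..1, Real.exp (s * t ^ 2) ≤ Real.exp s / s := by
  calc ∫ t in (0:ℝ)..1, Real.exp (s * t ^ 2) ≤ ∫ t in (0:ℝ)..1, Real.exp (s * t) := by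
        refine intervalIntegral.integral_mono_on zero_le_one
          (Continuous.intervalIntegrable (by fun_prop) _ _)
          (Continuous.intervalIntegrable (by fun_prop) _ _) fun t ht => ?_
        gcongr
        nlinarith [ht.1, ht.2]
    _ = (Real.exp s - 1) / s := integral_exp_mul_unitInterval hs.ne'
    _ ≤ Real.exp s / s := by gcongr; linarith

lemma le_integral_exp_mul_sq {s : ℝ} (hs : 1 ≤ s) :
    Real.exp s / (4 * s) ≤ ∫ t in (0:ℝ)..1, Real.exp (s * t ^ 2) := by
  have hs0 : 0 < s := by linarith
  have hexp : 2 ≤ Real.exp (2 * s) := by linarith [Real.add_one_le_exp (2 * s)]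
  calc Real.exp s / (4 * s) = Real.exp (-s) * ((Real.exp (2 * s) / 2) / (2 * s)) := by
        rw [two_mul s, Real.exp_add, Real.exp_neg]
        field_simp
        norm_num
    _ ≤ Real.exp (-s) * ((Real.exp (2 * s) - 1) / (2 * s)) := by gcongr; linarith
    _ = ∫ t in (0:ℝ)..1, Real.exp (-s) * Real.exp (2 * s * t) := by
        rw [intervalIntegral.integral_const_mul, integral_exp_mul_unitInterval (by positivity)]
    _ ≤ ∫ t in (0:ℝ)..1, Real.exp (s * t ^ 2) := by
        refine intervalIntegral.integral_mono_on zero_le_one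
          (Continuous.intervalIntegrable (by fun_prop) _ _)
          (Continuous.intervalIntegrable (by fun_prop) _ _) fun t _ => ?_
        rw [← Real.exp_add]
        gcongr
        nlinarith [mul_nonneg hs0.le (sq_nonneg (t - 1))]

/-- Trace of the weighted covariance operator: exact formula and
small-`λ` asymptotics. Here `k0 = k̃(0)` and `k_λ(x,x) = k0 · exp(2 λ^{-α} ‖x‖²)`. -/
theorem stmt_15 (d : ℕ) (hd : 0 < d) :
    (∀ (α lam k0 : ℝ), 0 < α → α < 1 / 2 → 0 < lam → 0 < k0 →
      (∫ x, k0 * Real.exp (2 * lam ^ (-α) * ‖x‖ ^ 2) ∂(μD d))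
        = 2 ^ (-(d : ℝ) / 2) * k0 * lam ^ (α * d / 2) *
          (∫ t in (0:ℝ)..Real.sqrt (2 / lam ^ α), Real.exp (t ^ 2)) ^ d) ∧
    (∃ lam0 c1 c2 : ℝ, 0 < lam0 ∧ 0 < c1 ∧ 0 < c2 ∧
      ∀ (α lam k0 : ℝ), 0 < α → α < 1 / 2 → 0 < lam → lam < lam0 → 0 < k0 →
        c1 * k0 * lam ^ (α * d) * Real.exp (2 * d / lam ^ α)
            ≤ (∫ x, k0 * Real.exp (2 * lam ^ (-α) * ‖x‖ ^ 2) ∂(μD d)) ∧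
        (∫ x, k0 * Real.exp (2 * lam ^ (-α) * ‖x‖ ^ 2) ∂(μD d))
            ≤ c2 * k0 * lam ^ (α * d) * Real.exp (2 * d / lam ^ α)) := by
  have key (α lam k0 : ℝ) : (∫ x, k0 * Real.exp (2 * lam ^ (-α) * ‖x‖ ^ 2) ∂(μD d)) =
      k0 * (∫ t in (0:ℝ)..1, Real.exp (2 * lam ^ (-α) * t ^ 2)) ^ d := by
    rw [integral_const_mul, integral_exp_mul_norm_sq_unitCube]
  have hscale (α lam : ℝ) (hlam : 0 < lam) : 2 / lam ^ α = 2 * lam ^ (-α) := by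
    rw [Real.rpow_neg hlam.le, div_eq_mul_inv]
  refine ⟨fun α lam k0 _ _ hlam _ => ?_, 1, (1 / 8) ^ d, (1 / 2) ^ d, one_pos, by positivity,
    by positivity, fun α lam k0 hα _ hlam hlam1 hk => ?_⟩
  · have hconst : (2:ℝ) ^ (-(d : ℝ) / 2) * lam ^ (α * d / 2) *
        Real.sqrt (2 * lam ^ (-α)) ^ d = 1 := by
      rw [Real.sqrt_eq_rpow, ← Real.rpow_natCast, ← Real.rpow_mul (by positivity),
        Real.mul_rpow (by positivity) (by positivity), ← Real.rpow_mul hlam.le]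
      calc _ = ((2:ℝ) ^ (-(d : ℝ) / 2) * 2 ^ (1 / 2 * (d : ℝ))) *
            (lam ^ (α * d / 2) * lam ^ (-α * (1 / 2 * (d : ℝ)))) := by ring
        _ = 1 := by
          rw [← Real.rpow_add two_pos, ← Real.rpow_add hlam]
          ring_nf
          simp
    rw [key, hscale α lam hlam, integral_exp_sq_sqrt (by positivity), mul_pow]
    linear_combination
      (-k0 * (∫ t in (0:ℝ)..1, Real.exp (2 * lam ^ (-α) * t ^ 2)) ^ d) * hconst
  · have hs : 1 ≤ 2 * lam ^ (-α) := by
      linarith [Real.one_le_rpow_of_pos_of_le_one_of_nonpos hlam hlam1.le (neg_nonpos.2 hα.le)]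
    have hbound (c : ℝ) : c ^ d * k0 * lam ^ (α * d) * Real.exp (2 * d / lam ^ α) =
        k0 * (c * lam ^ α * Real.exp (2 * lam ^ (-α))) ^ d := by
      rw [mul_pow, mul_pow, ← Real.rpow_mul_natCast hlam.le, ← Real.exp_nat_mul,
        ← hscale α lam hlam, show (d : ℝ) * (2 / lam ^ α) = 2 * d / lam ^ α by ring]
      ring
    have hpos : 0 < lam ^ α := by positivity
    rw [key, hbound, hbound]
    constructor
    · gcongr
      refine le_of_eq_of_le ?_ (le_integral_exp_mul_sq hs)
      rw [Real.rpow_neg hlam.le]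
      field_simp
      norm_num
    · gcongr
      · exact intervalIntegral.integral_nonneg zero_le_one fun t _ => (Real.exp_pos _).le
      refine (integral_exp_mul_sq_le (by linarith)).trans_eq ?_
      rw [Real.rpow_neg hlam.le]
      field_simp
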